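/- Suppose G is locally arc-transitive and ℓ = d/N. Then for every integer t ≥ 0, U_lazy^t |init_lazy⟩ = Û_lazy^t |init_lazy⟩; that is, replacing the oracle G_or by the modified oracle Ĝ_or does not alter the evolution of the walk applied to the initial state. -/

import Mathlib

open scoped BigOperators ComplexConjugate
open Complex

set_option linter.unusedSectionVars false

noncomputable section

namespace LQWPaper

variable {V : Type*} [Fintype V] [DecidableEq V]

/-- The inner product `⟨v,w⟩ = Σᵢ conj (v i) * w i` on `ι → ℂ`. -/
def cip {ι : Type*} [Fintype ι] (v w : ι → ℂ) : ℂ :=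
  ∑ i, (starRingEnd ℂ) (v i) * w i

/-- The `ℓ₂`-norm on `ι → ℂ`. -/
def l2norm {ι : Type*} [Fintype ι] (v : ι → ℂ) : ℝ :=
  Real.sqrt (∑ i, Complex.normSq (v i))

/-- The operator norm (with respect to the `ℓ₂`-norm) of a square matrix. -/
def opNorm {ι : Type*} [Fintype ι] (M : Matrix ι ι ℂ) : ℝ :=
  sSup {r : ℝ | ∃ v : ι → ℂ, l2norm v = 1 ∧ r = l2norm (M.mulVec v)}

/-- A fixed labeling `y_1(x), …, y_d(x)` of the `d` neighbors of each vertex of a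
`d`-regular graph: a bijection from `Fin d` to the neighbor set of each vertex. -/
structure Labeling (G : SimpleGraph V) (d : ℕ) where
  nbr : (x : V) → Fin d ≃ (G.neighborSet x)

lemma Labeling.adj {G : SimpleGraph V} {d : ℕ} (L : Labeling G d) (x : V) (i : Fin d) :
    G.Adj x (L.nbr x i) := (L.nbr x i).prop

/-- The (unique) index of `x` among the neighbors of `y`. -/
def Labeling.idx {G : SimpleGraph V} {d : ℕ} (L : Labeling G d) (y x : V)
    (h : G.Adj y x) : Fin d := (L.nbr y).symm ⟨x, h⟩

/-- The flip-flop shift on basis states: `|x, e_i⟩ ↦ |y, e_j⟩` where `y = y_i(x)` and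
`x = y_j(y)`, and `|x, ↻⟩ ↦ |x, ↻⟩`.  The self-loop is the coin index `Fin.last d`. -/
def shiftFun {G : SimpleGraph V} {d : ℕ} (L : Labeling G d)
    (p : V × Fin (d + 1)) : V × Fin (d + 1) :=
  if h : p.2 = Fin.last d then p
  else
    let i : Fin d := p.2.castPred h
    ⟨L.nbr p.1 i, Fin.castSucc (L.idx (L.nbr p.1 i) p.1 ((L.adj p.1 i).symm))⟩

/-- The flip-flop shift operator `S` as a matrix. -/
def shiftMat {G : SimpleGraph V} {d : ℕ} (L : Labeling G d) :
    Matrix (V × Fin (d + 1)) (V × Fin (d + 1)) ℂ :=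
  Matrix.of fun p q => if p = shiftFun L q then 1 else 0

/-- The coin state `|c⟩ = (1/√(d+ℓ)) (|e_1⟩ + ⋯ + |e_d⟩ + √ℓ |↻⟩)`. -/
def coinVec (d : ℕ) (ℓ : ℝ) : Fin (d + 1) → ℂ :=
  fun a => if a = Fin.last d then ((Real.sqrt ℓ / Real.sqrt (d + ℓ) : ℝ) : ℂ)
           else ((1 / Real.sqrt (d + ℓ) : ℝ) : ℂ)

/-- The coin operator `C = 2|c⟩⟨c| − I`. -/
def coinMat (d : ℕ) (ℓ : ℝ) : Matrix (Fin (d + 1)) (Fin (d + 1)) ℂ :=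
  (2 : ℂ) • Matrix.of (fun a b => coinVec d ℓ a * (starRingEnd ℂ) (coinVec d ℓ b)) - 1

/-- The global coin operator `I_N ⊗ C`. -/
def coinLift (d : ℕ) (ℓ : ℝ) :
    Matrix (V × Fin (d + 1)) (V × Fin (d + 1)) ℂ :=
  Matrix.of fun p q => if p.1 = q.1 then coinMat d ℓ p.2 q.2 else 0

/-- The oracle `G_or = (I_N − 2|m⟩⟨m|) ⊗ I_{d+1}`. -/
def oracleMat (d : ℕ) (m : V) : Matrix (V × Fin (d + 1)) (V × Fin (d + 1)) ℂ :=
  Matrix.of fun p q => if p = q then (if p.1 = m then -1 else 1) else 0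

/-- The lackadaisical quantum walk `U_lazy = S · (I_N ⊗ C) · G_or`. -/
def Ulazy {G : SimpleGraph V} {d : ℕ} (L : Labeling G d) (m : V) (ℓ : ℝ) :
    Matrix (V × Fin (d + 1)) (V × Fin (d + 1)) ℂ :=
  shiftMat L * coinLift d ℓ * oracleMat d m

/-- The initial state `|init_lazy⟩ = (1/√(N−1)) Σ_{x ≠ m} |x⟩ ⊗ |c⟩`. -/
def initLazy (m : V) (d : ℕ) (ℓ : ℝ) : V × Fin (d + 1) → ℂ :=
  fun p => if p.1 = m then 0
    else ((1 / Real.sqrt ((Fintype.card V : ℝ) - 1) : ℝ) : ℂ) * coinVec d ℓ p.2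

/-- The state `|⇒⟩ = (1/√d)(|e_1⟩ + ⋯ + |e_d⟩)`. -/
def plusVec (d : ℕ) : Fin (d + 1) → ℂ :=
  fun a => if a = Fin.last d then 0 else ((1 / Real.sqrt d : ℝ) : ℂ)

/-- The modified oracle `Ĝ_or = I − 2(|m,↻⟩⟨m,↻| + |m,⇒⟩⟨m,⇒|)`. -/
def oracleHat (d : ℕ) (m : V) : Matrix (V × Fin (d + 1)) (V × Fin (d + 1)) ℂ :=
  1 - (2 : ℂ) • Matrix.of (fun p q =>
    (if p = (m, Fin.last d) ∧ q = (m, Fin.last d) then 1 else 0)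
    + (if p.1 = m ∧ q.1 = m then plusVec d p.2 * (starRingEnd ℂ) (plusVec d q.2) else 0))

/-- The modified lackadaisical quantum walk `Û_lazy = S · (I_N ⊗ C) · Ĝ_or`. -/
def UlazyHat {G : SimpleGraph V} {d : ℕ} (L : Labeling G d) (m : V) (ℓ : ℝ) :
    Matrix (V × Fin (d + 1)) (V × Fin (d + 1)) ℂ :=
  shiftMat L * coinLift d ℓ * oracleHat d m

/-- The action of an automorphism `σ` of `G` on arcs and self-loops:
`P_σ |x, e_i⟩ = |σ x, e_j⟩` with `y_j(σ x) = σ (y_i x)`, and `P_σ |x, ↻⟩ = |σ x, ↻⟩`. -/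
def permFun {G : SimpleGraph V} {d : ℕ} (L : Labeling G d) (σ : G ≃g G)
    (p : V × Fin (d + 1)) : V × Fin (d + 1) :=
  if h : p.2 = Fin.last d then (σ p.1, p.2)
  else
    let i : Fin d := p.2.castPred h
    ⟨σ p.1, Fin.castSucc (L.idx (σ p.1) (σ (L.nbr p.1 i)) (σ.map_adj_iff.mpr (L.adj p.1 i)))⟩

/-- The unitary `P_σ` induced by an automorphism `σ` of `G`, as a matrix. -/
def permMat {G : SimpleGraph V} {d : ℕ} (L : Labeling G d) (σ : G ≃g G) :
    Matrix (V × Fin (d + 1)) (V × Fin (d + 1)) ℂ :=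
  Matrix.of fun p q => if p = permFun L σ q then 1 else 0

/-- `G` is locally arc-transitive if for any vertex `u` with neighbors `v₁, v₂` there is an
automorphism of `G` fixing `u` and mapping `v₁` to `v₂`. -/
def LocallyArcTransitive (G : SimpleGraph V) : Prop :=
  ∀ u v₁ v₂ : V, G.Adj u v₁ → G.Adj u v₂ → ∃ σ : G ≃g G, σ u = u ∧ σ v₁ = v₂

/-- The transition matrix `P` of the simple random walk on a `d`-regular graph. -/
def Pmat (G : SimpleGraph V) [DecidableRel G.Adj] (d : ℕ) : Matrix V V ℝ :=
  Matrix.of fun x y => if G.Adj x y then (1 : ℝ) / d else 0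

/-- The absorbing walk: row `m` is replaced by the unit vector at `m`. -/
def absorb (M : Matrix V V ℝ) (m : V) : Matrix V V ℝ :=
  Matrix.of fun x y => if x = m then (if y = m then 1 else 0) else M x y

/-- The interpolated walk `M(s) = (1−s) M + s M'`. -/
def interp (M : Matrix V V ℝ) (m : V) (s : ℝ) : Matrix V V ℝ :=
  (1 - s) • M + s • absorb M m

/-- The lazy random walk `P̂ = (d/(d+ℓ)) P + (ℓ/(d+ℓ)) I`. -/
def lazyP (G : SimpleGraph V) [DecidableRel G.Adj] (d : ℕ) (ℓ : ℝ) : Matrix V V ℝ :=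
  ((d : ℝ) / (d + ℓ)) • Pmat G d + (ℓ / (d + ℓ)) • (1 : Matrix V V ℝ)

/-- The submatrix `Q` of `P` obtained by deleting the row and column of `m`. -/
def Qsub (P : Matrix V V ℝ) (m : V) :
    Matrix {x : V // x ≠ m} {x : V // x ≠ m} ℝ :=
  Matrix.of fun x y => P x.1 y.1

/-- The hitting time `HT(P, {m}) = Σ_{t≥0} (1/N) Σ_{x≠m, y≠m} (Q^t)_{xy}`. -/
def hittingTime (P : Matrix V V ℝ) (m : V) : ℝ :=
  ∑' t : ℕ, (1 / (Fintype.card V : ℝ)) *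
    ∑ x : {x : V // x ≠ m}, ∑ y : {x : V // x ≠ m}, (Qsub P m ^ t) x y

/-- The state `|x⟩ ⊗ |P(s)_x⟩ = Σ_y √(P(s)_{xy}) |x,y⟩`. -/
def psVec (Ps : Matrix V V ℝ) (x : V) : V × V → ℂ :=
  fun p => if p.1 = x then ((Real.sqrt (Ps x p.2) : ℝ) : ℂ) else 0

/-- The projection `Π_A = Σ_x |x, P(s)_x⟩⟨x, P(s)_x|` onto `span{|x⟩ ⊗ |P(s)_x⟩}`. -/
def projA (Ps : Matrix V V ℝ) : Matrix (V × V) (V × V) ℂ :=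
  Matrix.of fun p q => ∑ x, psVec Ps x p * (starRingEnd ℂ) (psVec Ps x q)

/-- The swap of the two tensor factors of `ℂ^V ⊗ ℂ^V`, as a matrix. -/
def swapMat (V : Type*) [Fintype V] [DecidableEq V] : Matrix (V × V) (V × V) ℂ :=
  Matrix.of fun p q => if p.1 = q.2 ∧ p.2 = q.1 then 1 else 0

/-- Szegedy's quantum walk `W = SWAP · (2Π_A − I)` of a walk with matrix `Ps`. -/
def Wmat (Ps : Matrix V V ℝ) : Matrix (V × V) (V × V) ℂ :=
  swapMat V * ((2 : ℂ) • projA Ps - 1)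

/-- The initial state `|init_ip⟩ = (1/√(N−1)) Σ_{x ≠ m} |x⟩ ⊗ |P(s)_x⟩`. -/
def initIp (Ps : Matrix V V ℝ) (m : V) : V × V → ℂ :=
  fun p => if p.1 = m then 0
    else ((1 / Real.sqrt ((Fintype.card V : ℝ) - 1) : ℝ) : ℂ) * ((Real.sqrt (Ps p.1 p.2) : ℝ) : ℂ)

/-- The discriminant matrix, `D_{xy} = √(M_{xy} M_{yx})`. -/
def discr (M : Matrix V V ℝ) : Matrix V V ℝ :=
  Matrix.of fun x y => Real.sqrt (M x y * M y x)

/-- The unit vector `√π̄ = (1/√(N−1)) Σ_{x ≠ m} |x⟩`. -/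
def sqrtPiBar (m : V) : V → ℝ :=
  fun x => if x = m then 0 else 1 / Real.sqrt ((Fintype.card V : ℝ) - 1)

/-- `(θ, φ)` is an orthonormal eigenbasis of the (unitary) matrix `M`, with
eigenvalues `e^{iθ_k}` and eigenvectors `φ_k`. -/
def IsONEigenbasis {ι : Type*} [Fintype ι] [DecidableEq ι] (M : Matrix ι ι ℂ)
    (θ : ι → ℝ) (φ : ι → (ι → ℂ)) : Prop :=
  (∀ k l, cip (φ k) (φ l) = if k = l then 1 else 0) ∧
  (∀ k, M.mulVec (φ k) = Complex.exp ((θ k : ℂ) * Complex.I) • φ k)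

/-- The squared cotangent quantum hitting time
`QHT(U, w)² = Σ_{e^{iθ_k} ≠ 1} |⟨φ_k|w⟩|² cot²(θ_k/2)` computed in the
orthonormal eigenbasis `(θ, φ)`. -/
def QHTsq {ι : Type*} [Fintype ι] (θ : ι → ℝ) (φ : ι → (ι → ℂ)) (w : ι → ℂ) : ℝ :=
  ∑ k, if Complex.exp ((θ k : ℂ) * Complex.I) = 1 then 0
       else Complex.normSq (cip (φ k) w) * (Real.cos (θ k / 2) / Real.sin (θ k / 2)) ^ 2

/-- `(lam, v)` is a real orthonormal eigenbasis of the symmetric matrix `M`. -/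
def IsRealONEigenbasis (M : Matrix V V ℝ) (lam : V → ℝ) (v : V → (V → ℝ)) : Prop :=
  (∀ k l, (∑ x, v k x * v l x) = if k = l then 1 else 0) ∧
  (∀ k, M.mulVec (v k) = lam k • v k)

/-- The interpolated hitting time `HT⁺ = Σ_{λ_k ≠ 1} |⟨λ_k|√π̄⟩|² / (1 − λ_k)`,
computed in the orthonormal eigenbasis `(lam, v)` of the discriminant. -/
def HTplus (lam : V → ℝ) (v : V → (V → ℝ)) (m : V) : ℝ :=
  ∑ k, if lam k = 1 then 0 else (∑ x, v k x * sqrtPiBar m x) ^ 2 / (1 - lam k)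

/-- The map `E : ℂ^V ⊗ ℂ^V → ℂ^V ⊗ ℂ^{d+1}` with `E|x, y_i(x)⟩ = |x, e_i⟩`,
`E|x,x⟩ = |x,↻⟩` for `x ≠ m`, `E|m,m⟩ = −|m,↻⟩`, and `E|x,y⟩ = 0` otherwise. -/
def Emat {G : SimpleGraph V} [DecidableRel G.Adj] {d : ℕ}
    (L : Labeling G d) (m : V) : Matrix (V × Fin (d + 1)) (V × V) ℂ :=
  Matrix.of fun p q =>
    if h : G.Adj q.1 q.2 then
      (if p = (q.1, Fin.castSucc (L.idx q.1 q.2 h)) then 1 else 0)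
    else if q.2 = q.1 then
      (if p = (q.1, Fin.last d) then (if q.1 = m then -1 else 1) else 0)
    else 0

/-- `SWAP` applied to a vector of `ℂ^V ⊗ ℂ^V`. -/
def swapVecC (v : V × V → ℂ) : V × V → ℂ := fun p => v (p.2, p.1)

/-- The unit vector `|x, Ps_x^⊥⟩` orthogonal to `|x, Ps_x⟩` in
`span{|x, Ps_x⟩, SWAP |x, Ps_x⟩}` (Gram–Schmidt phase convention). -/
def perpVec (Ps : Matrix V V ℝ) (x : V) : V × V → ℂ :=
  fun p =>
    (swapVecC (psVec Ps x) - cip (psVec Ps x) (swapVecC (psVec Ps x)) • psVec Ps x) p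
      / ((l2norm (swapVecC (psVec Ps x) - cip (psVec Ps x) (swapVecC (psVec Ps x)) • psVec Ps x) : ℝ) : ℂ)

/-- The isometry `Σ_x (|x, Ps1_x⟩⟨x, Ps2_x| + |x, Ps1_x^⊥⟩⟨x, Ps2_x^⊥|)`;
`R₁ = Rmat P̂(s) P(s)` and `R₂ = Rmat P(s) P(s)`. -/
def Rmat (Ps1 Ps2 : Matrix V V ℝ) : Matrix (V × V) (V × V) ℂ :=
  Matrix.of fun p q => ∑ x, (psVec Ps1 x p * (starRingEnd ℂ) (psVec Ps2 x q)
    + perpVec Ps1 x p * (starRingEnd ℂ) (perpVec Ps2 x q))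

end LQWPaper

namespace LQWPaper

section Arcs

variable {V : Type*} [Fintype V] [DecidableEq V] {G : SimpleGraph V} {d : ℕ} (L : Labeling G d)

lemma Labeling.nbr_idx (y x : V) (h : G.Adj y x) : (L.nbr y (L.idx y x h) : V) = x := by
  simp [Labeling.idx]

/-- An arc is determined by its endpoints. -/
lemma Labeling.arc_ext {x y : V} {i j : Fin d} (hxy : x = y)
    (h : (L.nbr x i : V) = L.nbr y j) : (x, i.castSucc) = (y, j.castSucc) := by
  subst hxy
  rw [(L.nbr x).injective (Subtype.ext h)]

lemma shiftFun_last (x : V) : shiftFun L (x, Fin.last d) = (x, Fin.last d) := by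
  simp [shiftFun]

lemma shiftFun_castSucc (x : V) (i : Fin d) :
    shiftFun L (x, i.castSucc) =
      ((L.nbr x i : V), (L.idx (L.nbr x i) x (L.adj x i).symm).castSucc) := by
  simp [shiftFun]

lemma permFun_last (σ : G ≃g G) (x : V) :
    permFun L σ (x, Fin.last d) = (σ x, Fin.last d) := by
  simp [permFun]

lemma permFun_castSucc (σ : G ≃g G) (x : V) (i : Fin d) :
    permFun L σ (x, i.castSucc) =
      (σ x, (L.idx (σ x) (σ (L.nbr x i)) (σ.map_adj_iff.mpr (L.adj x i))).castSucc) := by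
  simp [permFun]

lemma permFun_fst (σ : G ≃g G) (p : V × Fin (d + 1)) : (permFun L σ p).1 = σ p.1 := by
  obtain ⟨x, a⟩ := p
  cases a using Fin.lastCases with
  | last => rw [permFun_last]
  | cast i => rw [permFun_castSucc]

lemma coinVec_permFun (ℓ : ℝ) (σ : G ≃g G) (p : V × Fin (d + 1)) :
    coinVec d ℓ (permFun L σ p).2 = coinVec d ℓ p.2 := by
  obtain ⟨x, a⟩ := p
  cases a using Fin.lastCases with
  | last => rw [permFun_last]
  | cast i => rw [permFun_castSucc]; simp [coinVec]

lemma permFun_injective (σ : G ≃g G) : Function.Injective (permFun L σ) := by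
  rintro ⟨x, a⟩ ⟨y, b⟩ h
  have hxy : x = y := by
    have := congrArg Prod.fst h
    simpa only [permFun_fst, EmbeddingLike.apply_eq_iff_eq] using this
  subst hxy
  cases a using Fin.lastCases with
  | last =>
    cases b using Fin.lastCases with
    | last => rfl
    | cast j => exact absurd (congrArg Prod.snd h).symm (by simp [permFun_last, permFun_castSucc])
  | cast i =>
    cases b using Fin.lastCases with
    | last => simp [permFun_last, permFun_castSucc] at h
    | cast j =>
      simp only [permFun_castSucc, Prod.mk.injEq, true_and, Fin.castSucc_inj] at h
      refine L.arc_ext rfl (σ.injective ?_)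
      have := congrArg (fun k => (L.nbr (σ x) k : V)) h
      simpa only [Labeling.nbr_idx] using this

lemma permFun_shiftFun (σ : G ≃g G) (p : V × Fin (d + 1)) :
    permFun L σ (shiftFun L p) = shiftFun L (permFun L σ p) := by
  obtain ⟨x, a⟩ := p
  cases a using Fin.lastCases with
  | last => simp only [permFun_last, shiftFun_last]
  | cast i =>
    simp only [permFun_castSucc, shiftFun_castSucc]
    refine L.arc_ext (L.nbr_idx _ _ _).symm ?_
    exact ((L.nbr_idx _ _ _).trans (congrArg σ (L.nbr_idx _ _ _))).trans (L.nbr_idx _ _ _).symm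

/-- The permutation of arcs and self-loops induced by a graph automorphism. -/
def permEquiv (σ : G ≃g G) : V × Fin (d + 1) ≃ V × Fin (d + 1) :=
  Equiv.ofBijective (permFun L σ) (Finite.injective_iff_bijective.mp (permFun_injective L σ))

lemma permEquiv_apply (σ : G ≃g G) (p : V × Fin (d + 1)) :
    permEquiv L σ p = permFun L σ p := rfl

lemma shiftMat_submatrix_permEquiv (σ : G ≃g G) :
    (shiftMat L).submatrix (permEquiv L σ) (permEquiv L σ) = shiftMat L := by
  ext p q
  simp only [shiftMat, Matrix.submatrix_apply, Matrix.of_apply, permEquiv_apply,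
    ← permFun_shiftFun, (permFun_injective L σ).eq_iff]

lemma coinLift_submatrix_permEquiv (ℓ : ℝ) (σ : G ≃g G) :
    (coinLift d ℓ).submatrix (permEquiv L σ) (permEquiv L σ) = coinLift (V := V) d ℓ := by
  ext p q
  simp only [coinLift, Matrix.submatrix_apply, Matrix.of_apply, permEquiv_apply, permFun_fst,
    EmbeddingLike.apply_eq_iff_eq]
  split_ifs with h
  · have h2 : (permFun L σ p).2 = (permFun L σ q).2 ↔ p.2 = q.2 := by
      have := (permFun_injective L σ).eq_iff (a := p) (b := q)
      simpa only [Prod.ext_iff, permFun_fst, h, true_and] using this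
    simp only [coinMat, Matrix.sub_apply, Matrix.smul_apply, Matrix.of_apply, Matrix.one_apply,
      coinVec_permFun, h2]
  · rfl

lemma oracleMat_submatrix_permEquiv {m : V} {σ : G ≃g G} (hσ : σ m = m) :
    (oracleMat d m).submatrix (permEquiv L σ) (permEquiv L σ) = oracleMat d m := by
  ext p q
  have h : σ p.1 = m ↔ p.1 = m := by
    conv_lhs => rw [← hσ, EmbeddingLike.apply_eq_iff_eq]
  simp only [oracleMat, Matrix.submatrix_apply, Matrix.of_apply, permEquiv_apply, permFun_fst,
    (permFun_injective L σ).eq_iff, h]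

lemma Ulazy_submatrix_permEquiv {m : V} (ℓ : ℝ) {σ : G ≃g G} (hσ : σ m = m) :
    (Ulazy L m ℓ).submatrix (permEquiv L σ) (permEquiv L σ) = Ulazy L m ℓ := by
  rw [Ulazy, ← Matrix.submatrix_mul_equiv _ _ _ (permEquiv L σ),
    ← Matrix.submatrix_mul_equiv _ _ _ (permEquiv L σ), shiftMat_submatrix_permEquiv,
    coinLift_submatrix_permEquiv, oracleMat_submatrix_permEquiv L hσ]

/-- `v` is fixed by every automorphism of `G` that fixes `m`. -/
def StabilizerInvariant (m : V) (v : V × Fin (d + 1) → ℂ) : Prop :=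
  ∀ σ : G ≃g G, σ m = m → v ∘ permEquiv L σ = v

lemma StabilizerInvariant.Ulazy_mulVec {m : V} {v : V × Fin (d + 1) → ℂ}
    (hv : StabilizerInvariant L m v) (ℓ : ℝ) :
    StabilizerInvariant L m ((Ulazy L m ℓ).mulVec v) := by
  intro σ hσ
  have h : v ∘ (permEquiv L σ).symm = v := by
    rw [Equiv.comp_symm_eq, hv σ hσ]
  conv_rhs => rw [← Ulazy_submatrix_permEquiv L ℓ hσ, Matrix.submatrix_mulVec_equiv, h]

lemma stabilizerInvariant_initLazy (m : V) (ℓ : ℝ) :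
    StabilizerInvariant L m (initLazy m d ℓ) := by
  intro σ hσ
  ext p
  have h : σ p.1 = m ↔ p.1 = m := by
    conv_lhs => rw [← hσ, EmbeddingLike.apply_eq_iff_eq]
  simp only [Function.comp_apply, initLazy, permEquiv_apply, permFun_fst, coinVec_permFun, h]

/-- If `G` is locally arc-transitive, an invariant vector has equal amplitudes on all arcs
leaving `m`. -/
lemma StabilizerInvariant.apply_castSucc_eq {m : V} {v : V × Fin (d + 1) → ℂ}
    (hv : StabilizerInvariant L m v) (hlat : LocallyArcTransitive G) (i j : Fin d) :
    v (m, i.castSucc) = v (m, j.castSucc) := by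
  obtain ⟨σ, hm, hσ⟩ := hlat m _ _ (L.adj m i) (L.adj m j)
  have h : permFun L σ (m, i.castSucc) = (m, j.castSucc) := by
    rw [permFun_castSucc]
    exact L.arc_ext hm (by rw [Labeling.nbr_idx, hσ])
  rw [← h]
  exact (congrFun (hv σ hm) (m, i.castSucc)).symm

end Arcs

lemma oracleMat_mulVec_apply {V : Type*} [Fintype V] [DecidableEq V] {d : ℕ} (m : V)
    (v : V × Fin (d + 1) → ℂ) (p : V × Fin (d + 1)) :
    (oracleMat d m).mulVec v p = if p.1 = m then -v p else v p := by
  simp only [oracleMat, Matrix.mulVec, dotProduct, Matrix.of_apply, ite_mul, zero_mul,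
    Finset.sum_ite_eq, Finset.mem_univ, if_true, neg_mul, one_mul]

lemma oracleHat_mulVec_apply {V : Type*} [Fintype V] [DecidableEq V] {d : ℕ} (m : V)
    (v : V × Fin (d + 1) → ℂ) (p : V × Fin (d + 1)) :
    (oracleHat d m).mulVec v p = v p - 2 * ((if p = (m, Fin.last d) then v p else 0) +
      if p.1 = m then plusVec d p.2 * ∑ i : Fin d, ((1 / Real.sqrt d : ℝ) : ℂ) * v (m, i.castSucc)
      else 0) := by
  rw [oracleHat, Matrix.sub_mulVec, Matrix.one_mulVec, Matrix.smul_mulVec, Pi.sub_apply,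
    Pi.smul_apply, smul_eq_mul]
  congr 2
  simp only [Matrix.mulVec, dotProduct, Matrix.of_apply, add_mul, Finset.sum_add_distrib]
  congr 1
  · by_cases hp : p = (m, Fin.last d) <;> simp [hp]
  · by_cases hp : p.1 = m
    · simp only [hp, true_and, if_true]
      rw [Fintype.sum_prod_type, Finset.sum_eq_single m]
      · simp [Fin.sum_univ_castSucc, plusVec, Finset.mul_sum, mul_assoc]
      · intro b _ hb
        simp [hb]
      · simp
    · simp [hp]

/-- The two oracles agree on vectors with equal amplitudes on all arcs leaving `m`. -/
lemma oracleMat_mulVec_eq_oracleHat_mulVec {V : Type*} [Fintype V] [DecidableEq V] {d : ℕ}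
    {m : V} {v : V × Fin (d + 1) → ℂ}
    (hv : ∀ i j : Fin d, v (m, i.castSucc) = v (m, j.castSucc)) :
    (oracleMat d m).mulVec v = (oracleHat d m).mulVec v := by
  ext ⟨x, a⟩
  rw [oracleMat_mulVec_apply, oracleHat_mulVec_apply]
  by_cases hx : x = m
  · subst hx
    cases a using Fin.lastCases with
    | last =>
      simp only [if_true, plusVec]
      ring
    | cast i =>
      have hd : (d : ℝ) ≠ 0 := by exact_mod_cast (Fin.pos i).ne'
      have hs : ((1 / Real.sqrt d : ℝ) : ℂ) * ((1 / Real.sqrt d : ℝ) : ℂ) * d = 1 := by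
        rw [← Complex.ofReal_mul, ← Complex.ofReal_natCast, ← Complex.ofReal_mul,
          div_mul_div_comm, Real.mul_self_sqrt (Nat.cast_nonneg d), one_mul,
          one_div_mul_cancel hd, Complex.ofReal_one]
      simp only [hv _ i, Finset.sum_const, Finset.card_univ, Fintype.card_fin, nsmul_eq_mul,
        if_true, plusVec, Prod.mk.injEq, true_and, Fin.castSucc_ne_last, if_false]
      linear_combination 2 * v (x, i.castSucc) * hs
  · simp [hx]

theorem statement_6 {V : Type*} [Fintype V] [DecidableEq V]
    (G : SimpleGraph V) [DecidableRel G.Adj] (d : ℕ) (L : Labeling G d) (m : V)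
    (hd : 1 ≤ d) (hN : 3 ≤ Fintype.card V) (hconn : G.Connected)
    (hreg : G.IsRegularOfDegree d) (hlat : LocallyArcTransitive G)
    (ℓ : ℝ) (hℓ : ℓ = d / (Fintype.card V : ℝ)) (t : ℕ) :
    (Ulazy L m ℓ ^ t).mulVec (initLazy m d ℓ) =
      (UlazyHat L m ℓ ^ t).mulVec (initLazy m d ℓ) := by
  have key : StabilizerInvariant L m ((Ulazy L m ℓ ^ t).mulVec (initLazy m d ℓ)) ∧
      (Ulazy L m ℓ ^ t).mulVec (initLazy m d ℓ) =
        (UlazyHat L m ℓ ^ t).mulVec (initLazy m d ℓ) := by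
    induction t with
    | zero => simpa using stabilizerInvariant_initLazy L m ℓ
    | succ t ih =>
      obtain ⟨hinv, heq⟩ := ih
      rw [pow_succ', pow_succ', ← Matrix.mulVec_mulVec, ← Matrix.mulVec_mulVec, ← heq]
      refine ⟨hinv.Ulazy_mulVec L ℓ, ?_⟩
      have horacle := oracleMat_mulVec_eq_oracleHat_mulVec (hinv.apply_castSucc_eq L hlat)
      calc _ = (shiftMat L * coinLift d ℓ).mulVec ((oracleMat d m).mulVec _) :=
            (Matrix.mulVec_mulVec ..).symm
        _ = (shiftMat L * coinLift d ℓ).mulVec ((oracleHat d m).mulVec _) :=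
            congrArg _ horacle
        _ = _ := Matrix.mulVec_mulVec ..
  exact key.2

end LQWPaper
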